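/- For |q|<1, the identity (1/(1-q)) Σ_{n=0}^∞ q^{n^2-n+1}(q^{n+1}-1)/(q;q)_n^2 = (q^2 - 2q)/((q;q)_∞ (1-q)) holds. -/

import Mathlib

open Finset

/-- (q;q)_n = ∏_{j=1}^n (1 - q^j). -/
noncomputable def qPoch (q : ℂ) (n : ℕ) : ℂ := ∏ j ∈ Finset.range n, (1 - q ^ (j + 1))

lemma aux_one_sub_ne (q : ℂ) (hq : ‖q‖ < 1) (j : ℕ) : 1 - q ^ (j + 1) ≠ 0 := by
  rw [sub_ne_zero]
  intro h
  have h1 : ‖q‖ ^ (j + 1) < 1 := pow_lt_one₀ (norm_nonneg _) hq (by omega)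
  rw [← norm_pow, ← h] at h1
  simp at h1

lemma aux_qPoch_ne (q : ℂ) (hq : ‖q‖ < 1) (n : ℕ) : qPoch q n ≠ 0 :=
  Finset.prod_ne_zero_iff.mpr fun j _ => aux_one_sub_ne q hq j

lemma aux_qPoch_succ (q : ℂ) (n : ℕ) : qPoch q (n + 1) = qPoch q n * (1 - q ^ (n + 1)) :=
  Finset.prod_range_succ _ _

lemma aux_qPoch_zero (q : ℂ) : qPoch q 0 = 1 := by simp [qPoch]

lemma aux_tendsto (q : ℂ) (hq : ‖q‖ < 1) :
    Filter.Tendsto (qPoch q) Filter.atTop (nhds (∏' j : ℕ, (1 - q ^ (j + 1)))) :=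
  (ModularForm.multipliable_one_sub_pow hq).hasProd.tendsto_prod_nat

lemma aux_prod_ne (q : ℂ) (hq : ‖q‖ < 1) : (∏' j : ℕ, (1 - q ^ (j + 1))) ≠ 0 := by
  have h := tprod_one_add_ne_zero_of_summable (f := fun n : ℕ ↦ -q ^ (n + 1))
    (fun i => by simpa [sub_eq_add_neg] using aux_one_sub_ne q hq i)
    (by simpa using (summable_nat_add_iff 1).mpr (summable_geometric_of_lt_one (norm_nonneg _) hq))
  simpa [sub_eq_add_neg] using h

lemma aux_bound (q : ℂ) (hq : ‖q‖ < 1) : ∃ B : ℝ, 0 ≤ B ∧ ∀ n, ‖(qPoch q n)⁻¹‖ ≤ B := by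
  have h := ((aux_tendsto q hq).inv₀ (aux_prod_ne q hq)).norm.bddAbove_range
  obtain ⟨B, hB⟩ := h
  have hB' : ∀ n, ‖(qPoch q n)⁻¹‖ ≤ B := fun n => hB ⟨n, rfl⟩
  exact ⟨B, (norm_nonneg _).trans (hB' 0), hB'⟩

/-- WZ telescoping. -/
lemma aux_wz (q : ℂ) (hq : ‖q‖ < 1) (k : ℕ) : ∀ d : ℕ,
    ∑ n ∈ range (k + 1), ((1 - q ^ (k + d + 1)) ^ 2 *
        (q ^ (n ^ 2) / (qPoch q n ^ 2 * qPoch q (k + d + 1 - n)))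
        - q ^ (n ^ 2) / (qPoch q n ^ 2 * qPoch q (k + d - n)))
      = - q ^ (d + (k + 1) ^ 2) / (qPoch q k ^ 2 * qPoch q d) := by
  induction k with
  | zero =>
    intro d
    have h1 := aux_qPoch_ne q hq d
    have h2 := aux_one_sub_ne q hq d
    simp [aux_qPoch_zero, aux_qPoch_succ]
    field_simp
    ring
  | succ k ih =>
    intro d
    rw [sum_range_succ]
    have := ih (d + 1)
    rw [show k + (d + 1) = k + 1 + d by ring] at this
    rw [this, show k + 1 + d + 1 - (k + 1) = d + 1 by omega, show k + 1 + d - (k + 1) = d by omega,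
      aux_qPoch_succ, aux_qPoch_succ]
    have h1 := aux_qPoch_ne q hq d
    have h2 := aux_one_sub_ne q hq d
    have h3 := aux_qPoch_ne q hq k
    have h4 := aux_one_sub_ne q hq k
    field_simp
    ring

lemma aux_finite (q : ℂ) (hq : ‖q‖ < 1) (N : ℕ) :
    ∑ n ∈ range (N + 1), q ^ (n ^ 2) / (qPoch q n ^ 2 * qPoch q (N - n))
      = 1 / qPoch q N ^ 2 := by
  induction N with
  | zero => simp [aux_qPoch_zero]
  | succ N ih =>
    have h := aux_wz q hq N 0
    simp only [add_zero, zero_add, aux_qPoch_zero, mul_one] at h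
    rw [sum_sub_distrib, ih, ← mul_sum] at h
    have h3 := aux_qPoch_ne q hq N
    have h4 := aux_one_sub_ne q hq N
    have h5 : (1 - q ^ (N + 1)) ^ 2 ≠ 0 := pow_ne_zero 2 h4
    rw [sum_range_succ, Nat.sub_self, aux_qPoch_zero]
    apply mul_left_cancel₀ h5
    rw [mul_add, sub_eq_iff_eq_add.mp h, aux_qPoch_succ]
    field_simp
    ring

lemma aux_summable_sq (q : ℂ) (hq : ‖q‖ < 1) : Summable fun n : ℕ => ‖q‖ ^ (n ^ 2) :=
  (summable_geometric_of_lt_one (norm_nonneg _) hq).of_nonneg_of_le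
    (fun _ => by positivity)
    (fun n => pow_le_pow_of_le_one (norm_nonneg _) hq.le (by nlinarith [Nat.le_self_pow two_ne_zero n]))

lemma aux_summable_u (q : ℂ) (hq : ‖q‖ < 1) :
    Summable fun n : ℕ => q ^ (n ^ 2) / qPoch q n ^ 2 := by
  obtain ⟨B, hB0, hB⟩ := aux_bound q hq
  refine Summable.of_norm_bounded ((aux_summable_sq q hq).mul_right (B ^ 2)) fun n => ?_
  rw [div_eq_mul_inv, norm_mul, norm_pow, ← inv_pow, norm_pow]
  gcongr
  exact hB n

lemma aux_summable_v (q : ℂ) (hq : ‖q‖ < 1) :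
    Summable fun n : ℕ => q ^ (n ^ 2 - n) / qPoch q n ^ 2 := by
  obtain ⟨B, hB0, hB⟩ := aux_bound q hq
  rw [← summable_nat_add_iff 1]
  refine Summable.of_norm_bounded
    ((summable_geometric_of_lt_one (norm_nonneg _) hq).mul_right (B ^ 2)) fun n => ?_
  rw [div_eq_mul_inv, norm_mul, norm_pow, ← inv_pow, norm_pow]
  refine mul_le_mul ?_ ?_ (by positivity) (by positivity)
  · apply pow_le_pow_of_le_one (norm_nonneg _) hq.le
    apply Nat.le_sub_of_add_le
    nlinarith
  · gcongr
    exact hB _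

/-- Euler's identity. -/
lemma aux_euler (q : ℂ) (hq : ‖q‖ < 1) :
    ∑' n : ℕ, q ^ (n ^ 2) / qPoch q n ^ 2 = 1 / ∏' j : ℕ, (1 - q ^ (j + 1)) := by
  obtain ⟨B, hB0, hB⟩ := aux_bound q hq
  have hP := aux_prod_ne q hq
  have ht := aux_tendsto q hq
  set P := ∏' j : ℕ, (1 - q ^ (j + 1)) with hPdef
  let f : ℕ → ℕ → ℂ := fun N n =>
    if n ∈ range (N + 1) then q ^ (n ^ 2) / (qPoch q n ^ 2 * qPoch q (N - n)) else 0
  have hlim : Filter.Tendsto (fun N => ∑' n, f N n) Filter.atTop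
      (nhds (∑' n, q ^ (n ^ 2) / (qPoch q n ^ 2 * P))) := by
    refine tendsto_tsum_of_dominated_convergence
      (bound := fun n => ‖q‖ ^ (n ^ 2) * (B ^ 2 * B)) ((aux_summable_sq q hq).mul_right _) ?_ ?_
    · intro n
      have h1 : Filter.Tendsto (fun N => q ^ (n ^ 2) / (qPoch q n ^ 2 * qPoch q (N - n)))
          Filter.atTop (nhds (q ^ (n ^ 2) / (qPoch q n ^ 2 * P))) := by
        refine Filter.Tendsto.div tendsto_const_nhds (tendsto_const_nhds.mul
          (ht.comp (Filter.tendsto_sub_atTop_nat n)))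
          (mul_ne_zero (pow_ne_zero 2 (aux_qPoch_ne q hq n)) hP)
      refine h1.congr' ?_
      filter_upwards [Filter.eventually_ge_atTop n] with N hN
      simp only [f, if_pos (mem_range.mpr (Nat.lt_succ_of_le hN))]
    · refine Filter.Eventually.of_forall fun N n => ?_
      simp only [f]
      split_ifs
      · rw [div_eq_mul_inv, mul_inv, norm_mul, norm_mul, norm_pow, ← inv_pow, norm_pow]
        gcongr
        · exact hB _
        · exact hB _
      · simp only [norm_zero]
        positivity
  have hsum : ∀ N, ∑' n, f N n = 1 / qPoch q N ^ 2 := by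
    intro N
    rw [← aux_finite q hq N, tsum_eq_sum (s := range (N + 1))]
    · exact sum_congr rfl fun n hn => by simp only [f, if_pos hn]
    · intro n hn
      simp only [f, if_neg hn]
  simp_rw [hsum] at hlim
  have h2 : Filter.Tendsto (fun N => 1 / qPoch q N ^ 2) Filter.atTop (nhds (1 / P ^ 2)) :=
    tendsto_const_nhds.div (ht.pow 2) (pow_ne_zero 2 hP)
  have h3 := tendsto_nhds_unique hlim h2
  simp_rw [← div_div] at h3
  rw [tsum_div_const] at h3
  rw [div_eq_iff hP] at h3
  rw [h3]
  field_simp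

lemma aux_tel (q : ℂ) (hq : ‖q‖ < 1) (k : ℕ) :
    ∑ n ∈ range (k + 1), (q ^ (n ^ 2 - n) / qPoch q n ^ 2 - 2 * (q ^ (n ^ 2) / qPoch q n ^ 2))
      = - (q ^ k * (q ^ (k ^ 2) / qPoch q k ^ 2)) := by
  induction k with
  | zero => simp [aux_qPoch_zero]; norm_num
  | succ k ih =>
    rw [sum_range_succ, ih, aux_qPoch_succ,
      show (k + 1) ^ 2 - (k + 1) = k ^ 2 + k by
        apply Nat.sub_eq_of_eq_add; ring]
    have h3 := aux_qPoch_ne q hq k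
    have h4 := aux_one_sub_ne q hq k
    field_simp
    ring

lemma aux_v (q : ℂ) (hq : ‖q‖ < 1) :
    ∑' n : ℕ, q ^ (n ^ 2 - n) / qPoch q n ^ 2 = 2 * ∑' n : ℕ, q ^ (n ^ 2) / qPoch q n ^ 2 := by
  have hu := aux_summable_u q hq
  have hv := aux_summable_v q hq
  have h1 := (hv.hasSum.sub (hu.hasSum.mul_left 2)).tendsto_sum_nat
  have h2 := (Filter.tendsto_add_atTop_iff_nat 1).mpr h1
  simp_rw [aux_tel q hq] at h2
  have h3 := ((tendsto_pow_atTop_nhds_zero_of_norm_lt_one hq).mul hu.tendsto_atTop_zero).neg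
  have h4 := tendsto_nhds_unique h2 h3
  simp only [mul_zero, neg_zero] at h4
  exact sub_eq_zero.mp h4

theorem euler_identity_shifted (q : ℂ) (hq : ‖q‖ < 1) :
    (1 / (1 - q)) * ∑' n : ℕ, q ^ (n ^ 2 - n + 1) * (q ^ (n + 1) - 1) / (qPoch q n) ^ 2
      = (q ^ 2 - 2 * q) / ((∏' j : ℕ, (1 - q ^ (j + 1))) * (1 - q)) := by
  have hu := aux_summable_u q hq
  have hv := aux_summable_v q hq
  have hterm : ∀ n : ℕ, q ^ (n ^ 2 - n + 1) * (q ^ (n + 1) - 1) / (qPoch q n) ^ 2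
      = q ^ 2 * (q ^ (n ^ 2) / qPoch q n ^ 2) - q * (q ^ (n ^ 2 - n) / qPoch q n ^ 2) := by
    intro n
    have h : q ^ (n ^ 2) = q ^ (n ^ 2 - n) * q ^ n := by
      rw [← pow_add, Nat.sub_add_cancel (Nat.le_self_pow two_ne_zero n)]
    rw [h]
    ring
  simp_rw [hterm]
  rw [(hu.mul_left _).tsum_sub (hv.mul_left _), tsum_mul_left, tsum_mul_left, aux_v q hq,
    aux_euler q hq]
  have hP := aux_prod_ne q hq
  have h1 : 1 - q ≠ 0 := by simpa using aux_one_sub_ne q hq 0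
  field_simp
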